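/- Assume (T1)–(T4). If there exist d₁,…,d_n > 0 such that for all t ∈ [0,ω] and all i: β̂_i(t) > Σ_{j,l=1}^{n} [Σ_{p=1}^{P} ζ_i|ĉ_{ijlp}(t)|((d_j/d_i)γ¹_{ijlp} + (d_l/d_i)γ²_{ijlp}) + Σ_{q=1}^{Q} ς_i|d̂_{ijlq}(t)|((d_j/d_i)μ¹_{ijlq}ξ_{ijq} + (d_l/d_i)μ²_{ijlq}Ξ_{ilq})], then system (Ĥ) has an ω-periodic solution, i.e. there is a continuous ω-periodic x̂ : ℝ → ℝ^n that is differentiable and satisfies (Ĥ) for all t > 0. -/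

import Mathlib

open MeasureTheory Filter

/-- Data of the high-order Cohen--Grossberg system, with `n+1` neurons,
`P+1` discrete-delay blocks and `Q+1` distributed-delay blocks. -/
structure HOData (n P Q : ℕ) where
  a : Fin (n+1) → ℝ → ℝ → ℝ
  b : Fin (n+1) → ℝ → ℝ → ℝ
  Gf : Fin (n+1) → ℝ → ℝ
  Hf : Fin (n+1) → ℝ → ℝ
  c : Fin (n+1) → Fin (n+1) → Fin (n+1) → Fin (P+1) → ℝ → ℝ
  d : Fin (n+1) → Fin (n+1) → Fin (n+1) → Fin (Q+1) → ℝ → ℝ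
  I : Fin (n+1) → ℝ → ℝ
  τ : Fin (n+1) → Fin (n+1) → Fin (P+1) → ℝ → ℝ
  σ : Fin (n+1) → Fin (n+1) → Fin (P+1) → ℝ → ℝ
  h : Fin (n+1) → Fin (n+1) → Fin (n+1) → Fin (P+1) → ℝ → ℝ → ℝ
  f : Fin (n+1) → Fin (n+1) → Fin (n+1) → Fin (Q+1) → ℝ → ℝ → ℝ
  g : Fin (n+1) → Fin (n+1) → Fin (Q+1) → ℝ → ℝ
  G : Fin (n+1) → Fin (n+1) → Fin (Q+1) → ℝ → ℝ
  η : Fin (n+1) → Fin (n+1) → Fin (Q+1) → Measure ℝ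
  ρ : Fin (n+1) → Fin (n+1) → Fin (Q+1) → Measure ℝ

namespace HOData

variable {n P Q : ℕ}

/-- Right-hand side of the high-order system. -/
noncomputable def rhs (S : HOData n P Q) (x : Fin (n+1) → ℝ → ℝ) (i : Fin (n+1)) (t : ℝ) : ℝ :=
  S.a i t (x i t) * (-(S.b i t (x i t))
    + S.Gf i (∑ p : Fin (P+1), ∑ j : Fin (n+1), ∑ l : Fin (n+1),
        S.c i j l p t * S.h i j l p (x j (t - S.τ i j p t)) (x l (t - S.σ i l p t)))
    + S.Hf i (∑ q : Fin (Q+1), ∑ j : Fin (n+1), ∑ l : Fin (n+1),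
        S.d i j l q t * S.f i j l q
          (∫ s in Set.Iic (0:ℝ), S.g i j q (x j (t + s)) ∂(S.η i j q))
          (∫ s in Set.Iic (0:ℝ), S.G i l q (x l (t + s)) ∂(S.ρ i l q)))
    + S.I i t)

/-- Standing regularity assumptions. -/
def Regular (S : HOData n P Q) : Prop :=
  (∀ i, ContinuousOn (fun q : ℝ × ℝ => S.a i q.1 q.2) (Set.Ici 0 ×ˢ Set.univ)) ∧
  (∀ i, ∀ t ≥ (0:ℝ), ∀ v, 0 < S.a i t v) ∧
  (∀ i, ContinuousOn (fun q : ℝ × ℝ => S.b i q.1 q.2) (Set.Ici 0 ×ˢ Set.univ)) ∧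
  (∀ i, Continuous (S.Gf i)) ∧ (∀ i, Continuous (S.Hf i)) ∧
  (∀ i j l p, ContinuousOn (S.c i j l p) (Set.Ici 0)) ∧
  (∀ i j l q, ContinuousOn (S.d i j l q) (Set.Ici 0)) ∧
  (∀ i, ContinuousOn (S.I i) (Set.Ici 0)) ∧
  (∀ i j p, ContinuousOn (S.τ i j p) (Set.Ici 0)) ∧
  (∀ i l p, ContinuousOn (S.σ i l p) (Set.Ici 0)) ∧
  (∀ i j p, ∀ t ≥ (0:ℝ), 0 ≤ S.τ i j p t) ∧
  (∀ i l p, ∀ t ≥ (0:ℝ), 0 ≤ S.σ i l p t) ∧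
  (∀ i j l p, Continuous (fun q : ℝ × ℝ => S.h i j l p q.1 q.2)) ∧
  (∀ i j l q, Continuous (fun r : ℝ × ℝ => S.f i j l q r.1 r.2)) ∧
  (∀ i j q, Continuous (S.g i j q)) ∧
  (∀ i l q, Continuous (S.G i l q)) ∧
  (∀ i j q, IsProbabilityMeasure (S.η i j q) ∧ S.η i j q (Set.Ioi 0) = 0) ∧
  (∀ i l q, IsProbabilityMeasure (S.ρ i l q) ∧ S.ρ i l q (Set.Ioi 0) = 0)

/-- A solution on `ℝ` with bounded initial condition at `t₀`. -/
def IsSolution (S : HOData n P Q) (t₀ : ℝ) (x : Fin (n+1) → ℝ → ℝ) : Prop :=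
  (∀ i, Continuous (x i)) ∧
  (∃ M, ∀ i, ∀ t ≤ t₀, |x i t| ≤ M) ∧
  (∀ i, ∀ t, t₀ < t → HasDerivAt (x i) (S.rhs x i t) t)

/-- Assumption (T1). -/
def T1 (S : HOData n P Q) (aL aU : Fin (n+1) → ℝ) (A : Fin (n+1) → ℝ → ℝ) : Prop :=
  (∀ i, 0 < aL i) ∧ (∀ i, aL i ≤ aU i) ∧
  (∀ i, ∀ t ≥ (0:ℝ), ∀ v, aL i ≤ S.a i t v ∧ S.a i t v ≤ aU i) ∧
  (∀ i, ∀ v : ℝ, ∀ t ≥ (0:ℝ),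
    ∃ da, HasDerivAt (fun s => S.a i s v) da t ∧ A i t * (S.a i t v) ^ 2 ≤ da)

/-- Assumption (T2): Lipschitz estimates. -/
def T2 (S : HOData n P Q)
    (γ1 γ2 : Fin (n+1) → Fin (n+1) → Fin (n+1) → Fin (P+1) → ℝ)
    (μ1 μ2 : Fin (n+1) → Fin (n+1) → Fin (n+1) → Fin (Q+1) → ℝ)
    (ξ Ξ : Fin (n+1) → Fin (n+1) → Fin (Q+1) → ℝ) (ζ ς : Fin (n+1) → ℝ) : Prop :=
  (∀ i j l p, 0 < γ1 i j l p ∧ 0 < γ2 i j l p) ∧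
  (∀ i j l q, 0 < μ1 i j l q ∧ 0 < μ2 i j l q) ∧
  (∀ i j q, 0 < ξ i j q) ∧ (∀ i l q, 0 < Ξ i l q) ∧ (∀ i, 0 < ζ i ∧ 0 < ς i) ∧
  (∀ i j l p u1 u2 v1 v2,
    |S.h i j l p u1 u2 - S.h i j l p v1 v2| ≤ γ1 i j l p * |u1 - v1| + γ2 i j l p * |u2 - v2|) ∧
  (∀ i j l q u1 u2 v1 v2,
    |S.f i j l q u1 u2 - S.f i j l q v1 v2| ≤ μ1 i j l q * |u1 - v1| + μ2 i j l q * |u2 - v2|) ∧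
  (∀ i j q u v, |S.g i j q u - S.g i j q v| ≤ ξ i j q * |u - v|) ∧
  (∀ i l q u v, |S.G i l q u - S.G i l q v| ≤ Ξ i l q * |u - v|) ∧
  (∀ i u v, |S.Gf i u - S.Gf i v| ≤ ζ i * |u - v|) ∧
  (∀ i u v, |S.Hf i u - S.Hf i v| ≤ ς i * |u - v|)

/-- Assumption (T3): ω-periodicity of the data. -/
def T3 (S : HOData n P Q) (ω : ℝ) : Prop :=
  (∀ i, ∀ t ≥ (0:ℝ), ∀ u, S.a i (t + ω) u = S.a i t u) ∧
  (∀ i, ∀ t ≥ (0:ℝ), ∀ u, S.b i (t + ω) u = S.b i t u) ∧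
  (∀ i j l p, ∀ t ≥ (0:ℝ), S.c i j l p (t + ω) = S.c i j l p t) ∧
  (∀ i j l q, ∀ t ≥ (0:ℝ), S.d i j l q (t + ω) = S.d i j l q t) ∧
  (∀ i j p, ∀ t ≥ (0:ℝ), S.τ i j p (t + ω) = S.τ i j p t) ∧
  (∀ i l p, ∀ t ≥ (0:ℝ), S.σ i l p (t + ω) = S.σ i l p t) ∧
  (∀ i, ∀ t ≥ (0:ℝ), S.I i (t + ω) = S.I i t)

/-- Assumption (T4): two-sided sector bounds on `b` by ω-periodic positive functions. -/
def T4 (S : HOData n P Q) (ω : ℝ) (β βs : Fin (n+1) → ℝ → ℝ) : Prop :=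
  (∀ i, ContinuousOn (β i) (Set.Ici 0)) ∧ (∀ i, ContinuousOn (βs i) (Set.Ici 0)) ∧
  (∀ i, ∀ t ≥ (0:ℝ), 0 < β i t ∧ 0 < βs i t) ∧
  (∀ i, ∀ t ≥ (0:ℝ), β i (t + ω) = β i t ∧ βs i (t + ω) = βs i t) ∧
  (∀ i, ∀ t ≥ (0:ℝ), ∀ u v : ℝ, u ≠ v →
    β i t ≤ (S.b i t u - S.b i t v) / (u - v) ∧ (S.b i t u - S.b i t v) / (u - v) ≤ βs i t)

end HOData

open HOData

open Topology

section Brouwer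

variable {E : Type*} [NormedAddCommGroup E] [InnerProductSpace ℝ E] [FiniteDimensional ℝ E]

/-- The polynomial map `t ↦ det (1 + t A)` is determined by its values at more than `dim E`
nodes. -/
theorem exists_weights_det_one_add (s : Finset ℝ)
    (hs : Module.finrank ℝ E < s.card) :
    ∃ w : ℝ → ℝ, ∑ k ∈ s, w k = 1 ∧ ∀ A : E →L[ℝ] E,
      (1 + A).det = ∑ k ∈ s, w k * (1 + k • A).det := by
  have hinj : Set.InjOn (id : ℝ → ℝ) s := Function.injective_id.injOn
  have key : ∀ p : Polynomial ℝ, p.degree < s.card →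
      p.eval 1 = ∑ k ∈ s, (Lagrange.basis s id k).eval 1 * p.eval k := by
    intro p hp
    conv_lhs => rw [Lagrange.eq_interpolate hinj hp]
    simp [Lagrange.interpolate_apply, Polynomial.eval_finsetSum, mul_comm]
  refine ⟨fun k => (Lagrange.basis s id k).eval 1, ?_, fun A => ?_⟩
  · have := key 1 (by
      rw [Polynomial.degree_one]
      exact_mod_cast (Nat.zero_le _).trans_lt hs)
    simpa using this.symm
  · let b := Module.finBasis ℝ E
    let M := LinearMap.toMatrix b b (A : E →ₗ[ℝ] E)
    let p : Polynomial ℝ := ((Polynomial.X : Polynomial ℝ) • M.map Polynomial.C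
      + (1 : Matrix _ _ ℝ).map Polynomial.C).det
    have hdet : ∀ t : ℝ, (1 + t • A).det = p.eval t := by
      intro t
      have h1 : (1 + t • A).det = (LinearMap.toMatrix b b ((1 + t • A : E →L[ℝ] E) : E →ₗ[ℝ] E)).det :=
        (LinearMap.det_toMatrix b _).symm
      have h2 : LinearMap.toMatrix b b ((1 + t • A : E →L[ℝ] E) : E →ₗ[ℝ] E) = 1 + t • M := by
        have : ((1 + t • A : E →L[ℝ] E) : E →ₗ[ℝ] E) = 1 + t • (A : E →ₗ[ℝ] E) := rfl
        rw [this, map_add, map_smul, LinearMap.toMatrix_one]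
      rw [h1, h2]
      simp only [p]
      rw [← Polynomial.coe_evalRingHom, RingHom.map_det]
      congr 1
      ext i j
      simp [Matrix.one_apply, add_comm]
      split_ifs <;> simp [mul_comm]
    have hp : p.degree < s.card := by
      refine lt_of_le_of_lt Polynomial.degree_le_natDegree ?_
      have := Polynomial.natDegree_det_X_add_C_le M 1
      rw [Fintype.card_fin] at this
      exact_mod_cast this.trans_lt hs
    have h1 := hdet 1
    rw [one_smul] at h1
    rw [h1, key p hp]
    simp [hdet]

theorem ContinuousLinearMap.det_one_add_pos (A : E →L[ℝ] E) (hA : ‖A‖ < 1) : 0 < (1 + A).det := by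
  have hne : ∀ s ∈ Set.Icc (0 : ℝ) 1, (1 + s • A).det ≠ 0 := by
    intro s hs h0
    have hn : ‖-(s • A)‖ < 1 := by
      rw [norm_neg, norm_smul, Real.norm_of_nonneg hs.1]
      exact (mul_le_of_le_one_left (norm_nonneg _) hs.2).trans_lt hA
    have hu : IsUnit (1 + s • A) := by
      simpa using isUnit_one_sub_of_norm_lt_one hn
    obtain ⟨x, hx, hx0⟩ := (Submodule.ne_bot_iff _).1 (LinearMap.bot_lt_ker_of_det_eq_zero h0).ne'
    obtain ⟨B, hB⟩ := hu.exists_left_inv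
    have h1 : (1 + s • A) x = 0 := hx
    apply hx0
    have h2 : (B * (1 + s • A)) x = x := by rw [hB]; rfl
    rw [← h2, mul_apply_eq_comp, h1, map_zero]
  have hc : Continuous fun s : ℝ => (1 + s • A).det :=
    ContinuousLinearMap.continuous_det.comp (by fun_prop)
  by_contra! hneg
  have h01 : (0 : ℝ) ∈ Set.Icc ((1 + (1 : ℝ) • A).det) ((1 + (0 : ℝ) • A).det) := by
    constructor
    · simpa using hneg
    · simp [ContinuousLinearMap.det]
  obtain ⟨s, hs, hs0⟩ := intermediate_value_Icc' zero_le_one hc.continuousOn h01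
  exact hne s hs hs0

variable [MeasurableSpace E] [BorelSpace E]

/-- There is no `C¹` retraction of the closed unit ball onto the unit sphere. -/
theorem not_exists_contDiff_retraction_sphere (r : E → E)
    (hr : ∀ x ∈ Metric.closedBall (0 : E) 1, ContDiffAt ℝ 1 r x)
    (hr1 : ∀ x ∈ Metric.closedBall (0 : E) 1, ‖r x‖ = 1)
    (hrs : ∀ x ∈ Metric.sphere (0 : E) 1, r x = x) : False := by
  classical
  let h : E → E := fun x => if ‖x‖ ≤ 1 then r x - x else 0
  let h' : E → E →L[ℝ] E := fun x => fderiv ℝ r x - 1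
  have hd : ∀ x ∈ Metric.closedBall (0 : E) 1, HasFDerivAt (fun x => r x - x) (h' x) x :=
    fun x hx => (((hr x hx).differentiableAt one_ne_zero).hasFDerivAt).sub (hasFDerivAt_id x)
  have hc' : ContinuousOn h' (Metric.closedBall (0 : E) 1) := fun x hx =>
    (((hr x hx).fderiv_right (m := 0) le_rfl).continuousAt.sub
      continuousAt_const).continuousWithinAt
  obtain ⟨C, hC⟩ := (isCompact_closedBall (0 : E) 1).exists_bound_of_continuousOn hc'
  have hC0 : 0 ≤ C := (norm_nonneg _).trans (hC 0 (by simp))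
  have hlip : ∀ x ∈ Metric.closedBall (0 : E) 1, ∀ y ∈ Metric.closedBall (0 : E) 1,
      ‖(r x - x) - (r y - y)‖ ≤ C * ‖x - y‖ := fun x hx y hy =>
    (convex_closedBall (0 : E) 1).norm_image_sub_le_of_norm_hasFDerivWithin_le
      (fun z hz => (hd z hz).hasFDerivWithinAt) hC hy hx
  have hmix : ∀ x y : E, ‖x‖ ≤ 1 → 1 < ‖y‖ → ‖r x - x‖ ≤ 2 * C * ‖x - y‖ := by
    intro x y hx hy
    have hy0 : ‖y‖ ≠ 0 := by linarith
    let z := ‖y‖⁻¹ • y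
    have hz : ‖z‖ = 1 := by simp [z, norm_smul, hy0]
    have hrz := hrs z (by simpa using hz)
    have h1 := hlip x (by simpa using hx) z (by simp [hz])
    rw [hrz, sub_self, sub_zero] at h1
    have h2 : ‖y - z‖ = ‖y‖ - 1 := by
      have : y - z = (1 - ‖y‖⁻¹) • y := by simp [z, sub_smul]
      rw [this, norm_smul, Real.norm_of_nonneg (by
        rw [sub_nonneg]; exact inv_le_one_of_one_le₀ hy.le), sub_mul, inv_mul_cancel₀ hy0, one_mul]
    have h3 : ‖x - z‖ ≤ ‖x - y‖ + ‖y - z‖ := norm_sub_le_norm_sub_add_norm_sub _ _ _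
    have h4 : ‖y‖ - ‖x‖ ≤ ‖x - y‖ := by rw [norm_sub_rev]; exact norm_sub_norm_le _ _
    nlinarith
  have hLip : ∀ x y : E, ‖h x - h y‖ ≤ 2 * C * ‖x - y‖ := by
    intro x y
    have hn : 0 ≤ C * ‖x - y‖ := by positivity
    simp only [h]
    split_ifs with hx hy hy
    · linarith [hlip x (by simpa using hx) y (by simpa using hy)]
    · simpa using hmix x y hx (not_le.1 hy)
    · rw [zero_sub, norm_neg, norm_sub_rev x y]
      exact hmix y x hy (not_le.1 hx)
    · simp only [sub_self, norm_zero]; linarith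
  have hvol : ∀ t : ℝ, 0 < t → t < 1 → t * (2 * C) < 1 →
      ∫ x in Metric.ball (0 : E) 1, (1 + t • h' x).det = volume.real (Metric.ball (0 : E) 1) := by
    intro t ht0 ht1 htC
    let g : E → E := fun x => x + t • h x
    have hA : ApproximatesLinearOn g ((ContinuousLinearEquiv.refl ℝ E : E ≃L[ℝ] E) : E →L[ℝ] E)
        Set.univ ⟨t * (2 * C), by positivity⟩ := by
      intro x _ y _
      have : g x - g y - (x - y) = t • (h x - h y) := by
        simp only [g, smul_sub]; abel
      change ‖g x - g y - (x - y)‖ ≤ t * (2 * C) * ‖x - y‖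
      rw [this, norm_smul, Real.norm_of_nonneg ht0.le, mul_assoc]
      exact mul_le_mul_of_nonneg_left (hLip x y) ht0.le
    have hcases : Subsingleton E ∨ (⟨t * (2 * C), by positivity⟩ : NNReal) <
        ‖((ContinuousLinearEquiv.refl ℝ E : E ≃L[ℝ] E).symm : E →L[ℝ] E)‖₊⁻¹ := by
      rcases subsingleton_or_nontrivial E with hE | hE
      · exact Or.inl hE
      · right
        have : ‖((ContinuousLinearEquiv.refl ℝ E : E ≃L[ℝ] E).symm : E →L[ℝ] E)‖₊ = 1 := by
          ext; exact ContinuousLinearMap.norm_id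
        rw [this, inv_one]
        exact NNReal.coe_lt_coe.1 htC
    have hginj : Function.Injective g := fun x y hxy =>
      congrArg Subtype.val (hA.injective hcases (a₁ := ⟨x, trivial⟩) (a₂ := ⟨y, trivial⟩) hxy)
    have hgsurj : Function.Surjective g := hA.surjective hcases
    have hout : ∀ x : E, 1 ≤ ‖x‖ → g x = x := by
      intro x hx
      simp only [g, h]
      split_ifs with hx1
      · rw [hrs x (by simpa using le_antisymm hx1 hx)]; simp
      · simp
    have himg : g '' Metric.ball (0 : E) 1 = Metric.ball (0 : E) 1 := by
      ext y
      simp only [Set.mem_image, mem_ball_zero_iff]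
      constructor
      · rintro ⟨x, hx, rfl⟩
        have : g x = (1 - t) • x + t • r x := by
          simp only [g, h, hx.le, if_true, sub_smul, smul_sub, one_smul]; abel
        rw [this]
        calc ‖(1 - t) • x + t • r x‖ ≤ ‖(1 - t) • x‖ + ‖t • r x‖ := norm_add_le _ _
          _ = (1 - t) * ‖x‖ + t := by
            rw [norm_smul, norm_smul, hr1 x (by simpa using hx.le), Real.norm_of_nonneg ht0.le,
              Real.norm_of_nonneg (by linarith), mul_one]
          _ < 1 := by nlinarith
      · intro hy
        obtain ⟨x, rfl⟩ := hgsurj y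
        refine ⟨x, ?_, rfl⟩
        by_contra! hx
        rw [hout x hx] at hy
        linarith
    have hder : ∀ x ∈ Metric.ball (0 : E) 1,
        HasFDerivWithinAt g (1 + t • h' x) (Metric.ball (0 : E) 1) x := by
      intro x hx
      have h1 : HasFDerivAt (fun x => x + t • (r x - x)) (1 + t • h' x) x :=
        (hasFDerivAt_id x).add ((hd x (Metric.ball_subset_closedBall hx)).const_smul t)
      refine h1.hasFDerivWithinAt.congr (fun y hy => ?_) ?_
      · simp only [g, h, if_pos (mem_ball_zero_iff.1 hy).le]
      · simp only [g, h, if_pos (mem_ball_zero_iff.1 hx).le]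
    have hpos : ∀ x ∈ Metric.ball (0 : E) 1, 0 < (1 + t • h' x).det := by
      intro x hx
      apply ContinuousLinearMap.det_one_add_pos
      rw [norm_smul, Real.norm_of_nonneg ht0.le]
      nlinarith [hC x (Metric.ball_subset_closedBall hx)]
    have := integral_image_eq_integral_abs_det_fderiv_smul volume measurableSet_ball hder
      hginj.injOn (fun _ => (1 : ℝ))
    rw [himg] at this
    simp only [integral_const, smul_eq_mul, mul_one, measureReal_restrict_apply_univ] at this
    rw [this]
    exact setIntegral_congr_fun measurableSet_ball fun x hx => (abs_of_pos (hpos x hx)).symm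
  have hdet0 : ∀ x ∈ Metric.ball (0 : E) 1, (1 + h' x).det = 0 := by
    intro x hx
    have e : 1 + h' x = fderiv ℝ r x := by simp [h']
    rw [e]
    by_contra hne
    have hx1 := hr1 x (Metric.ball_subset_closedBall hx)
    have hrd := ((hr x (Metric.ball_subset_closedBall hx)).differentiableAt one_ne_zero).hasFDerivAt
    have h1 := hrd.norm_sq
    have h2 : HasFDerivAt (fun y => ‖r y‖ ^ 2) (0 : E →L[ℝ] ℝ) x := by
      refine (hasFDerivAt_const (1 : ℝ) x).congr_of_eventuallyEq ?_
      filter_upwards [Metric.isOpen_ball.mem_nhds hx] with y hy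
      rw [hr1 y (Metric.ball_subset_closedBall hy)]; norm_num
    have h3 := h1.unique h2
    let L := LinearMap.equivOfDetNeZero (fderiv ℝ r x : E →ₗ[ℝ] E) hne
    obtain ⟨v, hv⟩ := L.surjective (r x)
    have hv' : fderiv ℝ r x v = r x := hv
    have h4 := DFunLike.congr_fun h3 v
    simp [hv', hx1] at h4
  obtain ⟨s, hs⟩ : ∃ s : Finset ℝ, s.card = Module.finrank ℝ E + 1 ∧
      ∀ t ∈ s, 0 < t ∧ t < 1 ∧ t * (2 * C) < 1 := by
    have hinf : (Set.Ioo (0 : ℝ) (min 1 (1 / (2 * C + 1)))).Infinite :=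
      Set.Ioo_infinite (by positivity)
    obtain ⟨s, hs1, hs2⟩ := hinf.exists_subset_card_eq (Module.finrank ℝ E + 1)
    refine ⟨s, hs2, fun t ht => ?_⟩
    obtain ⟨h0, h1⟩ := hs1 ht
    rw [lt_min_iff, lt_div_iff₀ (by positivity)] at h1
    exact ⟨h0, h1.1, by nlinarith⟩
  obtain ⟨w, hw1, hw⟩ := exists_weights_det_one_add (E := E) s (by omega)
  have hintegral : ∀ k ∈ s, IntegrableOn (fun x => w k * (1 + k • h' x).det) (Metric.ball (0 : E) 1) := by
    intro k _
    have hco : ContinuousOn (fun x => w k * (1 + k • h' x).det) (Metric.closedBall (0 : E) 1) :=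
      continuousOn_const.mul (ContinuousLinearMap.continuous_det.comp_continuousOn
        (continuousOn_const.add (hc'.const_smul k)))
    exact (hco.integrableOn_compact (isCompact_closedBall _ _)).mono_set
      Metric.ball_subset_closedBall
  have h1 : ∫ x in Metric.ball (0 : E) 1, (1 + h' x).det = 0 := by
    rw [setIntegral_congr_fun measurableSet_ball hdet0]; simp
  have h2 : ∫ x in Metric.ball (0 : E) 1, (1 + h' x).det = volume.real (Metric.ball (0 : E) 1) := by
    rw [integral_congr_ae (Eventually.of_forall fun x => hw (h' x)), integral_finsetSum _ hintegral]
    simp only [integral_const_mul]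
    rw [Finset.sum_congr rfl fun k hk => by rw [hvol k (hs.2 k hk).1 (hs.2 k hk).2.1 (hs.2 k hk).2.2],
      ← Finset.sum_mul, hw1, one_mul]
  have h3 : 0 < volume.real (Metric.ball (0 : E) 1) :=
    ENNReal.toReal_pos (Metric.measure_ball_pos _ _ one_pos).ne' measure_ball_lt_top.ne
  linarith

end Brouwer

section Brouwer

variable {E : Type*} [NormedAddCommGroup E] [InnerProductSpace ℝ E] [FiniteDimensional ℝ E]

/-- Brouwer's fixed point theorem for `C¹` self-maps of the closed unit ball. -/
theorem exists_fixedPoint_closedBall_of_contDiff (f : E → E) (hf : ContDiff ℝ 1 f)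
    (hmaps : ∀ x ∈ Metric.closedBall (0 : E) 1, ‖f x‖ ≤ 1) :
    ∃ x ∈ Metric.closedBall (0 : E) 1, f x = x := by
  borelize E
  by_contra! hne
  let u : E → E := fun x => x - f x
  let D : E → ℝ := fun x => inner ℝ x (u x) ^ 2 + ‖u x‖ ^ 2 * (1 - ‖x‖ ^ 2)
  let c : E → ℝ := fun x => (-inner ℝ x (u x) + √(D x)) / ‖u x‖ ^ 2
  have hu : ContDiff ℝ 1 u := contDiff_id.sub hf
  have hu0 : ∀ x ∈ Metric.closedBall (0 : E) 1, 0 < ‖u x‖ ^ 2 := by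
    intro x hx
    have : u x ≠ 0 := fun h => hne x hx (sub_eq_zero.1 h).symm
    positivity
  have hin : ContDiff ℝ 1 fun x => (inner ℝ x (u x) : ℝ) := contDiff_id.inner ℝ hu
  have hun : ContDiff ℝ 1 fun x => ‖u x‖ ^ 2 := hu.norm_sq ℝ
  have hD : ContDiff ℝ 1 D := (hin.pow 2).add (hun.mul (contDiff_const.sub (contDiff_norm_sq ℝ)))
  have hsphere : ∀ x : E, ‖x‖ = 1 → 0 < (inner ℝ x (u x) : ℝ) := by
    intro x hx
    have hx' : x ∈ Metric.closedBall (0 : E) 1 := by simp [hx]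
    have h1 := hu0 x hx'
    have h2 : ‖u x‖ ^ 2 = ‖x‖ ^ 2 - 2 * inner ℝ x (f x) + ‖f x‖ ^ 2 := norm_sub_sq_real _ _
    have h3 : (inner ℝ x (u x) : ℝ) = ‖x‖ ^ 2 - inner ℝ x (f x) := by
      simp only [u, inner_sub_right, real_inner_self_eq_norm_sq]
    have h4 := hmaps x hx'
    have h5 : ‖f x‖ ^ 2 ≤ 1 := by nlinarith [norm_nonneg (f x)]
    rw [hx] at h2 h3
    linarith
  have hDpos : ∀ x ∈ Metric.closedBall (0 : E) 1, 0 < D x := by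
    intro x hx
    have hx1 : ‖x‖ ≤ 1 := by simpa using hx
    rcases hx1.lt_or_eq with h | h
    · have h1 := hu0 x hx
      have : 0 < 1 - ‖x‖ ^ 2 := by nlinarith [norm_nonneg x]
      simp only [D]; positivity
    · have := hsphere x h
      simp only [D, h]
      norm_num
      positivity
  refine not_exists_contDiff_retraction_sphere (fun x => x + c x • u x) (fun x hx => ?_)
    (fun x hx => ?_) (fun x hx => ?_)
  · refine contDiffAt_id.add (ContDiffAt.smul ?_ hu.contDiffAt)
    exact ((hin.contDiffAt.neg).add (hD.contDiffAt.sqrt (hDpos x hx).ne')).div hun.contDiffAt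
      (hu0 x hx).ne'
  · have h1 := hu0 x hx
    have hs : √(D x) ^ 2 = inner ℝ x (u x) ^ 2 + ‖u x‖ ^ 2 * (1 - ‖x‖ ^ 2) :=
      Real.sq_sqrt (hDpos x hx).le
    have hc : c x * ‖u x‖ ^ 2 = -inner ℝ x (u x) + √(D x) := div_mul_cancel₀ _ h1.ne'
    have h2 : ‖x + c x • u x‖ ^ 2 = ‖x‖ ^ 2 + 2 * (c x * inner ℝ x (u x)) + c x ^ 2 * ‖u x‖ ^ 2 := by
      rw [norm_add_sq_real, real_inner_smul_right, norm_smul, mul_pow, Real.norm_eq_abs, sq_abs]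
    have h3 : ‖u x‖ ^ 2 * (‖x + c x • u x‖ ^ 2 - 1) = 0 := by
      rw [h2]
      have : ‖u x‖ ^ 2 * (‖x‖ ^ 2 + 2 * (c x * inner ℝ x (u x)) + c x ^ 2 * ‖u x‖ ^ 2 - 1)
          = (c x * ‖u x‖ ^ 2) ^ 2 + 2 * (c x * ‖u x‖ ^ 2) * inner ℝ x (u x)
            - ‖u x‖ ^ 2 * (1 - ‖x‖ ^ 2) := by ring
      rw [this, hc]
      linear_combination hs
    have h4 : ‖x + c x • u x‖ ^ 2 = 1 := by
      rcases mul_eq_zero.1 h3 with h | h <;> linarith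
    nlinarith [norm_nonneg (x + c x • u x)]
  · have hx1 : ‖x‖ = 1 := by simpa using hx
    have : c x = 0 := by
      simp [c, D, hx1, Real.sqrt_sq (hsphere x hx1).le]
    simp [this]

/-- Brouwer's fixed point theorem on the closed unit ball. -/
theorem exists_fixedPoint_of_norm_le_one (f : E → E) (hf : Continuous f) (hf1 : ∀ x, ‖f x‖ ≤ 1) :
    ∃ x, f x = x := by
  have happrox : ∀ ε > 0, ∃ x ∈ Metric.closedBall (0 : E) 1, ‖f x - x‖ < 2 * ε := by
    intro ε hε
    obtain ⟨g, hg⟩ := exists_contMDiffMap_forall_mem_convex_of_local_const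
      (I := modelWithCornersSelf ℝ E) (n := 1) (t := fun x => Metric.ball (f x) ε)
      (fun x => convex_ball _ _) (fun x => ⟨f x, by
        filter_upwards [hf.continuousAt.eventually (Metric.ball_mem_nhds (f x) hε)] with y hy
        exact Metric.mem_ball_comm.1 hy⟩)
    have hgc : ContDiff ℝ 1 g := g.contMDiff.contDiff
    have hgn : ∀ x, ‖g x - f x‖ < ε := fun x => by simpa [dist_eq_norm] using hg x
    have hg1 : ∀ x, ‖g x‖ ≤ 1 + ε := fun x => by
      have h1 := norm_le_norm_add_norm_sub' (g x) (f x)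
      have h2 := hgn x
      have h3 := hf1 x
      linarith
    obtain ⟨x, hx, hfx⟩ := exists_fixedPoint_closedBall_of_contDiff
      (fun x => (1 + ε)⁻¹ • g x) (contDiff_const.smul hgc) (fun x _ => by
        rw [norm_smul, norm_inv, Real.norm_of_nonneg (by positivity), inv_mul_le_iff₀ (by positivity),
          mul_one]
        exact hg1 x)
    refine ⟨x, hx, ?_⟩
    have hgx : g x = (1 + ε) • x := (inv_smul_eq_iff₀ (by positivity)).1 hfx
    have h2 : ‖g x - x‖ ≤ ε := by
      have : g x - x = ε • x := by rw [hgx, add_smul, one_smul, add_sub_cancel_left]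
      rw [this, norm_smul, Real.norm_of_nonneg hε.le]
      exact mul_le_of_le_one_right hε.le (by simpa using hx)
    have h3 := norm_sub_le_norm_sub_add_norm_sub (f x) (g x) x
    have h4 := hgn x
    rw [norm_sub_rev] at h4
    linarith
  obtain ⟨x, hx, hmin⟩ := (isCompact_closedBall (0 : E) 1).exists_isMinOn ⟨0, by simp⟩
    (hf.sub continuous_id).norm.continuousOn
  refine ⟨x, ?_⟩
  by_contra hne
  have hpos : 0 < ‖f x - x‖ := norm_pos_iff.2 (sub_ne_zero.2 hne)
  obtain ⟨y, hy, hlt⟩ := happrox (‖f x - x‖ / 2) (by positivity)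
  have : ‖f x - x‖ ≤ ‖f y - y‖ := hmin hy
  linarith

end Brouwer

/-- Schauder's fixed point theorem for a compact convex set. -/
theorem IsCompact.exists_fixedPoint_of_convex {E : Type*} [NormedAddCommGroup E] [NormedSpace ℝ E]
    {K : Set E} (hK : IsCompact K) (hconv : Convex ℝ K) (hne : K.Nonempty) (T : K → K)
    (hT : Continuous T) : ∃ x, T x = x := by
  classical
  have happrox : ∀ ε > 0, ∃ x : K, ‖(T x : E) - x‖ < ε := by
    intro ε hε
    obtain ⟨t, htK, hcov⟩ := hK.elim_nhds_subcover (fun x => Metric.ball x ε)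
      (fun x _ => Metric.ball_mem_nhds x hε)
    obtain ⟨v₀, hv₀⟩ := hne
    let φ : t → E → ℝ := fun i z => max 0 (ε - ‖z - i‖)
    let s : E → ℝ := fun z => ∑ i, φ i z
    have hφ0 : ∀ i z, 0 ≤ φ i z := fun i z => le_max_left _ _
    have hφc : ∀ i, Continuous (φ i) := fun i => by simp only [φ]; fun_prop
    have hsc : Continuous s := continuous_finsetSum _ fun i _ => hφc i
    have hs : ∀ z ∈ K, 0 < s z := by
      intro z hz
      obtain ⟨x, hx, hzx⟩ := Set.mem_iUnion₂.1 (hcov hz)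
      refine Finset.sum_pos' (fun i _ => hφ0 i z) ⟨⟨x, hx⟩, Finset.mem_univ _, ?_⟩
      rw [mem_ball_iff_norm] at hzx
      exact lt_max_of_lt_right (by linarith)
    let W : EuclideanSpace ℝ t → ℝ := fun w => ∑ i, max (w i) 0
    have hW0 : ∀ w, 0 ≤ W w := fun w => Finset.sum_nonneg fun i _ => le_max_right _ _
    let q : EuclideanSpace ℝ t → E := fun w =>
      (max 1 (W w))⁻¹ • (∑ i, max (w i) 0 • (i : E) + max (1 - W w) 0 • v₀)
    have hm : ∀ w, 0 < max 1 (W w) := fun w => lt_max_of_lt_left one_pos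
    have hWc : Continuous W := by simp only [W]; fun_prop
    have hqc : Continuous q := by
      refine Continuous.smul ((continuous_const.max hWc).inv₀ fun w => (hm w).ne') ?_
      fun_prop
    have hqK : ∀ w, q w ∈ K := by
      intro w
      have hsum : W w + max (1 - W w) 0 = max 1 (W w) := by
        rcases le_total 1 (W w) with h | h
        · rw [max_eq_right h, max_eq_right (by linarith), add_zero]
        · rw [max_eq_left h, max_eq_left (by linarith)]; ring
      have h := hconv.sum_mem (t := Finset.univ)
        (w := fun o : Option t => (max 1 (W w))⁻¹ * o.elim (max (1 - W w) 0) fun i => max (w i) 0)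
        (z := fun o : Option t => o.elim v₀ fun i => (i : E)) ?_ ?_ ?_
      · simpa [q, Fintype.sum_option, mul_smul, Finset.smul_sum, smul_add, add_comm] using h
      · rintro (_ | i) _
        · exact mul_nonneg (inv_nonneg.2 (hm w).le) (le_max_right _ _)
        · exact mul_nonneg (inv_nonneg.2 (hm w).le) (le_max_right _ _)
      · rw [← Finset.mul_sum, Fintype.sum_option]
        simp only [Option.elim]
        change (max 1 (W w))⁻¹ * (max (1 - W w) 0 + W w) = 1
        rw [add_comm, hsum, inv_mul_cancel₀ (hm w).ne']
      · rintro (_ | i) _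
        · exact hv₀
        · exact htK i i.2
    let p : K → EuclideanSpace ℝ t := fun z => WithLp.toLp 2 fun i => φ i z / s z
    have hpc : Continuous p := by
      refine (PiLp.continuous_toLp 2 _).comp (continuous_pi fun i => ?_)
      exact ((hφc i).comp continuous_subtype_val).div (hsc.comp continuous_subtype_val)
        fun z => (hs z z.2).ne'
    have hp0 : ∀ z i, 0 ≤ p z i := fun z i => div_nonneg (hφ0 _ _) (hs z z.2).le
    have hp1 : ∀ z, ∑ i, p z i = 1 := fun z => by
      change ∑ i, φ i z / s z = 1
      rw [← Finset.sum_div]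
      exact div_self (hs z z.2).ne'
    have hpn : ∀ z, ‖p z‖ ≤ 1 := by
      intro z
      rw [EuclideanSpace.norm_eq]
      refine Real.sqrt_le_iff.2 ⟨zero_le_one, ?_⟩
      rw [one_pow, ← hp1 z]
      refine Finset.sum_le_sum fun i _ => ?_
      have : p z i ≤ 1 := by
        rw [← hp1 z]; exact Finset.single_le_sum (fun j _ => hp0 z j) (Finset.mem_univ i)
      rw [Real.norm_of_nonneg (hp0 z i)]
      nlinarith [hp0 z i]
    obtain ⟨w, hw⟩ := exists_fixedPoint_of_norm_le_one (fun w => p (T ⟨q w, hqK w⟩))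
      (hpc.comp (hT.comp (hqc.subtype_mk hqK))) (fun w => hpn _)
    refine ⟨⟨q w, hqK w⟩, ?_⟩
    set z : K := T ⟨q w, hqK w⟩ with hz
    have hWw : W w = 1 := by
      simp only [W]
      rw [← hp1 z, ← hw]
      exact Finset.sum_congr rfl fun i _ => max_eq_left (hp0 _ i)
    have hqw : q w = ∑ i, p z i • (i : E) := by
      simp only [q, hWw, sub_self, max_self, zero_smul, add_zero, inv_one, one_smul]
      refine Finset.sum_congr rfl fun i _ => ?_
      have hwi : w i = p z i := by rw [← hw]
      rw [hwi, max_eq_left (hp0 _ i)]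
    have hdiff : (z : E) - q w = ∑ i, p z i • ((z : E) - i) := by
      simp only [smul_sub, Finset.sum_sub_distrib, ← Finset.sum_smul, hp1, one_smul, hqw]
    change ‖(z : E) - q w‖ < ε
    rw [hdiff]
    have hle : ∀ i, ‖p z i • ((z : E) - i)‖ ≤ p z i * ε := by
      intro i
      rw [norm_smul, Real.norm_of_nonneg (hp0 z i)]
      by_cases h : ‖(z : E) - i‖ < ε
      · exact mul_le_mul_of_nonneg_left h.le (hp0 z i)
      · have : p z i = 0 := by
          change φ i z / s z = 0
          simp only [φ]
          rw [max_eq_left (by linarith [not_lt.1 h]), zero_div]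
        simp [this]
    obtain ⟨i, hi⟩ : ∃ i, 0 < p z i := by
      by_contra! h
      have := hp1 z
      have h0 : ∑ i, p z i ≤ 0 := Finset.sum_nonpos fun i _ => h i
      linarith
    calc ‖∑ i, p z i • ((z : E) - i)‖ ≤ ∑ i, ‖p z i • ((z : E) - i)‖ := norm_sum_le _ _
      _ < ∑ i, p z i * ε := by
        refine Finset.sum_lt_sum (fun i _ => hle i) ⟨i, Finset.mem_univ _, ?_⟩
        rw [norm_smul, Real.norm_of_nonneg hi.le]
        refine mul_lt_mul_of_pos_left ?_ hi
        by_contra h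
        have : p z i = 0 := by
          change φ i z / s z = 0
          simp only [φ]
          rw [max_eq_left (by linarith [not_lt.1 h]), zero_div]
        exact hi.ne' this
      _ = ε := by rw [← Finset.sum_mul, hp1, one_mul]
  have : CompactSpace K := isCompact_iff_compactSpace.1 hK
  obtain ⟨x, -, hmin⟩ := isCompact_univ.exists_isMinOn (s := (Set.univ : Set K))
    ⟨⟨_, hne.some_mem⟩, trivial⟩
    (((continuous_subtype_val.comp hT).sub continuous_subtype_val).norm.continuousOn)
  refine ⟨x, ?_⟩
  by_contra h
  have hpos : 0 < ‖(T x : E) - x‖ :=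
    norm_pos_iff.2 (sub_ne_zero.2 fun h' => h (Subtype.ext h'))
  obtain ⟨y, hlt⟩ := happrox _ hpos
  exact absurd (hmin (Set.mem_univ y)) (not_le.2 hlt)

/-- Periodic extension to the whole line of a map that is continuous and `ω`-periodic on
`[0, ∞)`. -/
theorem exists_continuous_periodic_extension {X Y : Type*} [TopologicalSpace X]
    [TopologicalSpace Y] {ω : ℝ} (hω : 0 < ω) (f : ℝ → X → Y)
    (hf : ContinuousOn (Function.uncurry f) (Set.Ici 0 ×ˢ Set.univ))
    (hp : ∀ t ≥ 0, ∀ x, f (t + ω) x = f t x) :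
    ∃ g : ℝ → X → Y, Continuous (Function.uncurry g) ∧ (∀ t x, g (t + ω) x = g t x) ∧
      (∀ t ≥ 0, g t = f t) ∧ ∀ t, ∃ s ∈ Set.Icc 0 ω, g t = f s := by
  have hpn : ∀ (k : ℕ) (t : ℝ), 0 ≤ t → f (t + k * ω) = f t := by
    intro k
    induction k with
    | zero => intro t _; simp
    | succ k ih =>
      intro t ht
      have h1 : 0 ≤ t + k * ω := by positivity
      rw [← ih t ht, Nat.cast_succ, add_mul, one_mul, ← add_assoc]
      exact funext fun x => hp _ h1 x
  let g : ℝ → X → Y := fun t x => f (toIcoMod hω 0 t) x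
  have hg0 : ∀ t, 0 ≤ toIcoMod hω 0 t := fun t => (toIcoMod_mem_Ico' hω t).1
  have hgp : ∀ t, g (t + ω) = g t := fun t => by simp only [g, toIcoMod_add_right]
  have hgpn : ∀ (k : ℕ) t, g (t + k * ω) = g t := by
    intro k
    induction k with
    | zero => intro t; simp
    | succ k ih => intro t; rw [← ih t, Nat.cast_succ, add_mul, one_mul, ← add_assoc, hgp]
  have hgf : ∀ t ≥ 0, g t = f t := by
    intro t ht
    have h1 := toIcoMod_add_toIcoDiv_mul hω 0 t
    have h2 := (toIcoMod_mem_Ico' hω t).2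
    have h3 : 0 ≤ toIcoDiv hω 0 t := by
      by_contra! h
      have h4 : ((toIcoDiv hω 0 t : ℤ) : ℝ) ≤ -1 := by exact_mod_cast Int.le_sub_one_of_lt h
      nlinarith
    obtain ⟨k, hk⟩ := Int.eq_ofNat_of_zero_le h3
    rw [hk] at h1
    push_cast at h1
    conv_rhs => rw [← h1]
    exact (hpn k _ (hg0 t)).symm
  refine ⟨g, ?_, fun t x => by rw [hgp], hgf,
    fun t => ⟨_, Set.Ico_subset_Icc_self (toIcoMod_mem_Ico' hω t), rfl⟩⟩
  rw [continuous_iff_continuousAt]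
  rintro ⟨t₀, x₀⟩
  obtain ⟨k, hk⟩ := exists_nat_gt (-t₀ / ω)
  have hk' : 0 < t₀ + k * ω := by
    rw [div_lt_iff₀ hω] at hk; linarith
  have h1 : ContinuousAt (Function.uncurry f) (t₀ + k * ω, x₀) :=
    hf.continuousAt (prod_mem_nhds (Ici_mem_nhds hk') univ_mem)
  have h2 : ContinuousAt (fun p : ℝ × X => (p.1 + k * ω, p.2)) (t₀, x₀) := by fun_prop
  have h3 : ContinuousAt (fun p : ℝ × X => Function.uncurry f (p.1 + k * ω, p.2)) (t₀, x₀) :=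
    ContinuousAt.comp (g := Function.uncurry f) h1 h2
  refine h3.congr ?_
  have h4 : ∀ᶠ p : ℝ × X in 𝓝 (t₀, x₀), 0 < p.1 + k * ω :=
    (show Continuous fun p : ℝ × X => p.1 + k * ω by fun_prop).continuousAt.eventually
      (lt_mem_nhds hk')
  filter_upwards [h4] with p hp'
  simp only [Function.uncurry]
  rw [← hgf _ hp'.le, hgpn]

/-- The `ω`-periodic solution of `x' = -M x + ψ` for `ω`-periodic continuous `ψ`. -/
noncomputable def periodicRelaxation (ω M : ℝ) (ψ : ℝ → ℝ) (t : ℝ) : ℝ :=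
  (1 - Real.exp (-(M * ω)))⁻¹ * Real.exp (-(M * t)) *
    ((∫ u in (0 : ℝ)..t, Real.exp (M * u) * ψ u) - ∫ u in (0 : ℝ)..(t - ω), Real.exp (M * u) * ψ u)

section Relaxation

variable {ω M : ℝ} {ψ : ℝ → ℝ}

theorem one_sub_exp_neg_pos (hω : 0 < ω) (hM : 0 < M) : 0 < 1 - Real.exp (-(M * ω)) := by
  rw [sub_pos, Real.exp_lt_one_iff]
  have := mul_pos hM hω
  linarith

theorem hasDerivAt_periodicRelaxation (hω : 0 < ω) (hM : 0 < M) (hψ : Continuous ψ)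
    (hper : ∀ t, ψ (t + ω) = ψ t) (t : ℝ) :
    HasDerivAt (periodicRelaxation ω M ψ) (-M * periodicRelaxation ω M ψ t + ψ t) t := by
  have hc : Continuous fun u => Real.exp (M * u) * ψ u := by fun_prop
  have h1 : ∀ s, HasDerivAt (fun s => ∫ u in (0 : ℝ)..s, Real.exp (M * u) * ψ u)
      (Real.exp (M * s) * ψ s) s := fun s =>
    intervalIntegral.integral_hasDerivAt_right (hc.intervalIntegrable _ _)
      hc.aestronglyMeasurable.stronglyMeasurableAtFilter hc.continuousAt
  have h2 := (h1 (t - ω)).comp_sub_const t ω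
  have h3 : HasDerivAt (fun t => Real.exp (-(M * t))) (Real.exp (-(M * t)) * -(M * 1)) t :=
    (((hasDerivAt_id t).const_mul M).neg).exp
  have h4 := (h3.const_mul (1 - Real.exp (-(M * ω)))⁻¹).mul ((h1 t).sub h2)
  refine h4.congr_deriv ?_
  have hψ' : ψ (t - ω) = ψ t := by rw [← hper (t - ω), sub_add_cancel]
  have hne := (one_sub_exp_neg_pos hω hM).ne'
  have e1 : Real.exp (-(M * t)) * Real.exp (M * t) = 1 := by rw [← Real.exp_add]; simp
  have e2 : Real.exp (-(M * t)) * Real.exp (M * (t - ω)) = Real.exp (-(M * ω)) := by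
    rw [← Real.exp_add]; ring_nf
  rw [hψ']
  simp only [periodicRelaxation, Pi.sub_apply]
  have e3 : (1 - Real.exp (-(M * ω)))⁻¹ * Real.exp (-(M * t)) *
      (Real.exp (M * t) * ψ t - Real.exp (M * (t - ω)) * ψ t) = ψ t := by
    have : (1 - Real.exp (-(M * ω)))⁻¹ * Real.exp (-(M * t)) *
      (Real.exp (M * t) * ψ t - Real.exp (M * (t - ω)) * ψ t) = (1 - Real.exp (-(M * ω)))⁻¹ *
      (Real.exp (-(M * t)) * Real.exp (M * t) - Real.exp (-(M * t)) * Real.exp (M * (t - ω)))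
        * ψ t := by ring
    rw [this, e1, e2, inv_mul_cancel₀ hne, one_mul]
  rw [e3]
  ring

theorem periodicRelaxation_eq (hψ : Continuous ψ) (t : ℝ) :
    periodicRelaxation ω M ψ t = (1 - Real.exp (-(M * ω)))⁻¹ * Real.exp (-(M * t)) *
      ∫ u in (t - ω)..t, Real.exp (M * u) * ψ u := by
  have hc : Continuous fun u => Real.exp (M * u) * ψ u := by fun_prop
  rw [periodicRelaxation, intervalIntegral.integral_interval_sub_left (hc.intervalIntegrable _ _)
    (hc.intervalIntegrable _ _)]

theorem periodicRelaxation_add_period (hψ : Continuous ψ) (hper : ∀ t, ψ (t + ω) = ψ t) (t : ℝ) :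
    periodicRelaxation ω M ψ (t + ω) = periodicRelaxation ω M ψ t := by
  rw [periodicRelaxation_eq hψ, periodicRelaxation_eq hψ]
  have h1 := intervalIntegral.integral_comp_add_right (a := t - ω) (b := t)
    (fun u => Real.exp (M * u) * ψ u) ω
  have h2 : ∀ u, Real.exp (M * (u + ω)) * ψ (u + ω) =
      Real.exp (M * ω) * (Real.exp (M * u) * ψ u) := fun u => by
    rw [hper, mul_add, Real.exp_add]; ring
  simp only [h2, intervalIntegral.integral_const_mul, sub_add_cancel] at h1
  rw [add_sub_cancel_right, ← h1, mul_add, neg_add, Real.exp_add]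
  have e : Real.exp (-(M * ω)) * Real.exp (M * ω) = 1 := by rw [← Real.exp_add]; simp
  linear_combination ((1 - Real.exp (-(M * ω)))⁻¹ * Real.exp (-(M * t)) *
    ∫ u in (t - ω)..t, Real.exp (M * u) * ψ u) * e

theorem abs_periodicRelaxation_le (hω : 0 < ω) (hM : 0 < M) (hψ : Continuous ψ) {R : ℝ}
    (hR : ∀ t, |ψ t| ≤ M * R) (t : ℝ) : |periodicRelaxation ω M ψ t| ≤ R := by
  have hpos := one_sub_exp_neg_pos hω hM
  have hintegral : ∫ u in (t - ω)..t, Real.exp (M * u) * (M * R) =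
      R * Real.exp (M * t) * (1 - Real.exp (-(M * ω))) := by
    have hd : ∀ u, HasDerivAt (fun u => Real.exp (M * u) * R) (Real.exp (M * u) * (M * R)) u :=
      fun u => by
        have := (((hasDerivAt_id u).const_mul M).exp).mul_const R
        simpa [mul_assoc] using this
    rw [intervalIntegral.integral_eq_sub_of_hasDerivAt (fun u _ => hd u)
      (Continuous.intervalIntegrable (by fun_prop) _ _), mul_sub M t ω, sub_eq_add_neg (M * t),
      Real.exp_add]
    ring
  have hle : ‖∫ u in (t - ω)..t, Real.exp (M * u) * ψ u‖ ≤
      ∫ u in (t - ω)..t, Real.exp (M * u) * (M * R) := by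
    refine intervalIntegral.norm_integral_le_of_norm_le (by linarith)
      (Eventually.of_forall fun u _ => ?_) (Continuous.intervalIntegrable (by fun_prop) _ _)
    rw [norm_mul, Real.norm_of_nonneg (Real.exp_pos _).le]
    exact mul_le_mul_of_nonneg_left (hR u) (Real.exp_pos _).le
  rw [hintegral] at hle
  have e1 : Real.exp (-(M * t)) * Real.exp (M * t) = 1 := by rw [← Real.exp_add]; simp
  rw [periodicRelaxation_eq hψ, abs_mul, abs_of_pos (by positivity)]
  calc _ ≤ (1 - Real.exp (-(M * ω)))⁻¹ * Real.exp (-(M * t)) *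
        (R * Real.exp (M * t) * (1 - Real.exp (-(M * ω)))) :=
        mul_le_mul_of_nonneg_left hle (by positivity)
    _ = R * (Real.exp (-(M * t)) * Real.exp (M * t)) *
        ((1 - Real.exp (-(M * ω)))⁻¹ * (1 - Real.exp (-(M * ω)))) := by ring
    _ = R := by rw [e1, inv_mul_cancel₀ hpos.ne', mul_one, mul_one]

end Relaxation

section Periodic

variable {ι : Type*} {ω : ℝ}

/-- Periodic functions bounded componentwise by `R` and Lipschitz with constant `L`. -/
def lipschitzBox (ω : ℝ) (R : ι → ℝ) (L : ℝ) : Set C(AddCircle ω, ι → ℝ) :=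
  {y | (∀ θ i, |y θ i| ≤ R i) ∧ ∀ (s t : ℝ) i, |y s i - y t i| ≤ L * |s - t|}

theorem convex_lipschitzBox (R : ι → ℝ) (L : ℝ) : Convex ℝ (lipschitzBox ω R L) := by
  intro y hy z hz a b ha hb hab
  refine ⟨fun θ i => ?_, fun s t i => ?_⟩
  · have h1 := hy.1 θ i
    have h2 := hz.1 θ i
    simp only [ContinuousMap.add_apply, ContinuousMap.smul_apply, Pi.add_apply, Pi.smul_apply,
      smul_eq_mul]
    rw [abs_le] at *
    constructor <;> nlinarith
  · have h1 := hy.2 s t i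
    have h2 := hz.2 s t i
    simp only [ContinuousMap.add_apply, ContinuousMap.smul_apply, Pi.add_apply, Pi.smul_apply,
      smul_eq_mul]
    rw [abs_le] at *
    constructor <;> nlinarith

variable [Fintype ι]

theorem isCompact_lipschitzBox (R : ι → ℝ) (L : ℝ) : IsCompact (lipschitzBox ω R L) := by
  apply ArzelaAscoli.isCompact_of_equicontinuous
  · have himg : ContinuousMap.toFun '' lipschitzBox ω R L =
        (Set.univ.pi fun _ : AddCircle ω => Set.univ.pi fun i => Set.Icc (-R i) (R i)) ∩
          {φ | ∀ (s t : ℝ) i, |φ s i - φ t i| ≤ L * |s - t|} := by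
      ext φ
      constructor
      · rintro ⟨y, hy, rfl⟩
        exact ⟨fun θ _ i _ => abs_le.1 (hy.1 θ i), hy.2⟩
      · rintro ⟨h1, h2⟩
        have hc : Continuous φ := by
          rw [← QuotientAddGroup.isOpenQuotientMap_mk.continuous_comp_iff, continuous_pi_iff]
          intro i
          refine (LipschitzWith.of_dist_le_mul (K := Real.toNNReal L) fun s t => ?_).continuous
          rw [Real.dist_eq, Real.dist_eq]
          exact (h2 s t i).trans (mul_le_mul_of_nonneg_right (Real.le_coe_toNNReal L) (abs_nonneg _))
        exact ⟨⟨φ, hc⟩, ⟨fun θ i => abs_le.2 (h1 θ trivial i trivial), h2⟩, rfl⟩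
    rw [himg]
    refine (isCompact_univ_pi fun _ => isCompact_univ_pi fun i => isCompact_Icc).inter_right ?_
    simp only [Set.ofPred_forall]
    refine isClosed_iInter fun s => isClosed_iInter fun t => isClosed_iInter fun i =>
      isClosed_le ?_ continuous_const
    fun_prop
  · intro θ
    induction θ using QuotientAddGroup.induction_on with
    | H t =>
      rw [Metric.equicontinuousAt_iff_right]
      intro ε hε
      rw [QuotientAddGroup.nhds_eq, eventually_map]
      have h1 : ∀ᶠ s : ℝ in 𝓝 t, L * |t - s| < ε := by
        have : Continuous fun s : ℝ => L * |t - s| := by fun_prop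
        exact this.continuousAt.eventually (gt_mem_nhds (by simpa using hε))
      filter_upwards [h1] with s hs y
      refine (dist_pi_lt_iff hε).2 fun i => ?_
      exact (y.2.2 t s i).trans_lt hs

/-- Periodic solutions of functional differential equations whose right-hand side points inward
along the boundary of a box. -/
theorem exists_periodic_solution_of_box (hω : 0 < ω) (R : ι → ℝ) (hR : ∀ i, 0 ≤ R i) {M : ℝ}
    (hM : 0 < M) (F : (ι → ℝ → ℝ) → ι → ℝ → ℝ)
    (hcont : ∀ i, ContinuousOn (fun p : ℝ × {y : C(AddCircle ω, ι → ℝ) // ∀ θ i, |y θ i| ≤ R i} =>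
      F (fun i t => p.2.1 t i) i p.1) (Set.Ici 0 ×ˢ Set.univ))
    (hper : ∀ y : ι → ℝ → ℝ, (∀ i t, y i (t + ω) = y i t) → ∀ i, ∀ t ≥ 0, F y i (t + ω) = F y i t)
    (hbound : ∀ y : ι → ℝ → ℝ, (∀ i, Continuous (y i)) → (∀ i t, y i (t + ω) = y i t) →
      (∀ i t, |y i t| ≤ R i) → ∀ i, ∀ t ∈ Set.Icc 0 ω, |M * y i t + F y i t| ≤ M * R i) :
    ∃ x : ι → ℝ → ℝ, (∀ i, Continuous (x i)) ∧ (∀ i t, x i (t + ω) = x i t) ∧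
      ∀ i t, 0 < t → HasDerivAt (x i) (F x i t) t := by
  have : Fact (0 < ω) := ⟨hω⟩
  let L : ℝ := 2 * M * ∑ i, R i
  let K := lipschitzBox ω R L
  let lift : K → ι → ℝ → ℝ := fun y i t => y.1 t i
  have hlc : ∀ y i, Continuous (lift y i) := fun y i =>
    (continuous_apply i).comp (y.1.continuous.comp (AddCircle.continuous_mk' ω))
  have hlp : ∀ y i t, lift y i (t + ω) = lift y i t := fun y i t => by
    simp only [lift, AddCircle.coe_add_period]
  have hlR : ∀ y i t, |lift y i t| ≤ R i := fun y i t => y.2.1 t i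
  have heval : ∀ i, Continuous fun p : ℝ × K => lift p.2 i p.1 := fun i =>
    (continuous_apply i).comp ((continuous_subtype_val.comp continuous_snd).eval
      ((AddCircle.continuous_mk' ω).comp continuous_fst))
  have hext : ∀ i, ∃ g : ℝ → K → ℝ, Continuous (Function.uncurry g) ∧
      (∀ t x, g (t + ω) x = g t x) ∧
      (∀ t ≥ 0, g t = fun y => M * lift y i t + F (lift y) i t) ∧
      ∀ t, ∃ s ∈ Set.Icc 0 ω, g t = fun y => M * lift y i s + F (lift y) i s := by
    intro i
    refine exists_continuous_periodic_extension hω (fun t y => M * lift y i t + F (lift y) i t)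
      ?_ fun t ht y => ?_
    · refine ((heval i).const_mul M).continuousOn.add ?_
      have hincl : Continuous fun p : ℝ × K =>
          ((p.1, ⟨p.2.1, p.2.2.1⟩) : ℝ × {y : C(AddCircle ω, ι → ℝ) // ∀ θ i, |y θ i| ≤ R i}) :=
        continuous_fst.prodMk ((continuous_subtype_val.comp continuous_snd).subtype_mk _)
      exact (hcont i).comp (s := Set.Ici 0 ×ˢ Set.univ) hincl.continuousOn
        fun p hp => ⟨hp.1, trivial⟩
    · rw [hlp, hper _ (hlp y) i t ht]
  choose g hgc hgp hgf hgs using hext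
  have hgR : ∀ i y t, |g i t y| ≤ M * R i := by
    intro i y t
    obtain ⟨s, hs, h⟩ := hgs i t
    rw [h]
    exact hbound _ (hlc y) (hlp y) (hlR y) i s hs
  have hgy : ∀ i y, Continuous fun t => g i t y := fun i y =>
    (hgc i).comp (by fun_prop : Continuous fun t : ℝ => (t, y))
  let X : K → ι → ℝ → ℝ := fun y i => periodicRelaxation ω M fun t => g i t y
  have hXd : ∀ y i t, HasDerivAt (X y i) (-M * X y i t + g i t y) t := fun y i t =>
    hasDerivAt_periodicRelaxation hω hM (hgy i y) (fun t => hgp i t y) t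
  have hXp : ∀ y i t, X y i (t + ω) = X y i t := fun y i t =>
    periodicRelaxation_add_period (hgy i y) (fun t => hgp i t y) t
  have hXR : ∀ y i t, |X y i t| ≤ R i := fun y i t =>
    abs_periodicRelaxation_le hω hM (hgy i y) (hgR i y) t
  have hXL : ∀ y i s t, |X y i s - X y i t| ≤ L * |s - t| := by
    intro y i s t
    have hRi : R i ≤ ∑ i, R i := Finset.single_le_sum (fun j _ => hR j) (Finset.mem_univ i)
    refine convex_univ.norm_image_sub_le_of_norm_hasDerivWithin_le
      (fun u _ => (hXd y i u).hasDerivWithinAt) (fun u _ => ?_) (Set.mem_univ t) (Set.mem_univ s)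
    calc ‖-M * X y i u + g i u y‖ ≤ ‖-M * X y i u‖ + ‖g i u y‖ := norm_add_le _ _
      _ ≤ M * R i + M * R i := by
        refine add_le_add ?_ (hgR i y u)
        rw [norm_mul, norm_neg, Real.norm_of_nonneg hM.le]
        exact mul_le_mul_of_nonneg_left (hXR y i u) hM.le
      _ ≤ L := by simp only [L]; nlinarith
  have hXc : ∀ i, Continuous fun p : K × ℝ => X p.1 i p.2 := by
    intro i
    have hprim : Continuous fun p : K × ℝ => ∫ u in (0 : ℝ)..p.2, Real.exp (M * u) * g i u p.1 := by
      refine intervalIntegral.continuous_parametric_primitive_of_continuous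
        (f := fun (y : K) u => Real.exp (M * u) * g i u y) ?_
      have := (hgc i).comp (continuous_swap : Continuous (Prod.swap : K × ℝ → ℝ × K))
      exact (by fun_prop : Continuous fun p : K × ℝ => Real.exp (M * p.2)).mul this
    have hprim' := hprim.comp (by fun_prop : Continuous fun p : K × ℝ => (p.1, p.2 - ω))
    simp only [X, periodicRelaxation]
    exact (by fun_prop : Continuous fun p : K × ℝ =>
      (1 - Real.exp (-(M * ω)))⁻¹ * Real.exp (-(M * p.2))).mul (hprim.sub hprim')
  have hV : ∀ y, Function.Periodic (fun t i => X y i t) ω := fun y t => funext fun i => hXp y i t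
  have hVc : Continuous (Function.uncurry fun (y : K) (θ : AddCircle ω) => (hV y).lift θ) := by
    rw [← (IsOpenQuotientMap.id.prodMap QuotientAddGroup.isOpenQuotientMap_mk).continuous_comp_iff]
    exact continuous_pi hXc
  let T₀ : K → C(AddCircle ω, ι → ℝ) := fun y =>
    ⟨(hV y).lift, hVc.comp (by fun_prop : Continuous fun θ : AddCircle ω => (y, θ))⟩
  have hT₀ : Continuous T₀ := ContinuousMap.continuous_of_continuous_uncurry _ hVc
  have hT₀K : ∀ y, T₀ y ∈ K := by
    refine fun y => ⟨fun θ i => ?_, fun s t i => hXL y i s t⟩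
    induction θ using QuotientAddGroup.induction_on with
    | H t => exact hXR y i t
  have hL : 0 ≤ L := by
    have := Finset.sum_nonneg fun i (_ : i ∈ Finset.univ) => hR i
    positivity
  have hne : K.Nonempty :=
    ⟨0, fun θ i => by simpa using hR i, fun s t i => by simpa using mul_nonneg hL (abs_nonneg _)⟩
  obtain ⟨y, hy⟩ := IsCompact.exists_fixedPoint_of_convex (K := K) (isCompact_lipschitzBox R L)
    (convex_lipschitzBox R L) hne (fun y => ⟨T₀ y, hT₀K y⟩) (hT₀.subtype_mk hT₀K)
  have hfix : ∀ i t, lift y i t = X y i t := by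
    intro i t
    have h1 : T₀ y = y.1 := congrArg Subtype.val hy
    change y.1 t i = _
    rw [← h1]
    rfl
  refine ⟨lift y, hlc y, hlp y, fun i t ht => ?_⟩
  have h1 := hXd y i t
  rw [hgf i t ht.le] at h1
  have h2 : X y i = lift y i := funext fun t => (hfix i t).symm
  rw [h2] at h1
  refine h1.congr_deriv ?_
  ring

end Periodic

theorem abs_mul_add_mul_le_of_slope {a aU β βs D M R v : ℝ} {b : ℝ → ℝ} (ha : 0 ≤ a)
    (haU : a ≤ aU) (hβs : 0 ≤ βs)
    (hb : ∀ u v, u ≠ v → β ≤ (b u - b v) / (u - v) ∧ (b u - b v) / (u - v) ≤ βs)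
    (hv : |v| ≤ R) (hD : |-b 0 + D| ≤ β * R) (hM : aU * βs ≤ M) :
    |M * v + a * (-b v + D)| ≤ M * R := by
  have hlo : ∀ u v, v ≤ u → β * (u - v) ≤ b u - b v := by
    intro u v huv
    rcases huv.eq_or_lt with rfl | h
    · simp
    · exact (le_div_iff₀ (sub_pos.2 h)).1 (hb u v h.ne').1
  have hhi : ∀ u v, v ≤ u → b u - b v ≤ βs * (u - v) := by
    intro u v huv
    rcases huv.eq_or_lt with rfl | h
    · simp
    · exact (div_le_iff₀ (sub_pos.2 h)).1 (hb u v h.ne').2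
  have hR : 0 ≤ R := (abs_nonneg v).trans hv
  have haM : a * βs ≤ M := (mul_le_mul_of_nonneg_right haU hβs).trans hM
  rw [abs_le] at hv hD ⊢
  have h1 := hlo R 0 hR
  have h2 := hlo 0 (-R) (by linarith)
  have h3 := hhi R v hv.2
  have h4 := hhi v (-R) hv.1
  have h5 : a * (-b v + D) ≤ a * (βs * (R - v)) := mul_le_mul_of_nonneg_left (by linarith) ha
  have h6 : a * (-(βs * (v - -R))) ≤ a * (-b v + D) := mul_le_mul_of_nonneg_left (by linarith) ha
  have h7 := mul_le_mul_of_nonneg_right haM (sub_nonneg.2 hv.2)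
  have h8 := mul_le_mul_of_nonneg_right haM (sub_nonneg.2 hv.1)
  constructor <;> linarith

theorem abs_setIntegral_comp_sub_le {η : Measure ℝ} [IsProbabilityMeasure η] {g u : ℝ → ℝ}
    {ξ R : ℝ} (s : Set ℝ) (hξ : 0 ≤ ξ) (hg : ∀ u v, |g u - g v| ≤ ξ * |u - v|) (hu : Continuous u)
    (hR : ∀ t, |u t| ≤ R) :
    |(∫ t in s, g (u t) ∂η) - ∫ _ in s, g 0 ∂η| ≤ ξ * R := by
  have hR0 : 0 ≤ R := (abs_nonneg _).trans (hR 0)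
  have hgc : Continuous g := (LipschitzWith.of_dist_le_mul (K := ⟨ξ, hξ⟩) hg).continuous
  have hd : ∀ t, ‖g (u t) - g 0‖ ≤ ξ * R := fun t =>
    (hg _ _).trans (mul_le_mul_of_nonneg_left (by simpa using hR t) hξ)
  have hintegral : Integrable (fun t => g (u t)) (η.restrict s) := by
    refine Integrable.of_bound (hgc.comp hu).aestronglyMeasurable (ξ * R + ‖g 0‖)
      (Eventually.of_forall fun t => ?_)
    have := norm_sub_norm_le (g (u t)) (g 0)
    linarith [hd t]
  rw [← integral_sub hintegral (integrable_const _), ← Real.norm_eq_abs]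
  refine (norm_integral_le_of_norm_le_const (Eventually.of_forall hd)).trans ?_
  rw [measureReal_restrict_apply_univ]
  exact mul_le_of_le_one_right (by positivity) measureReal_le_one

theorem continuous_setIntegral_comp_add {ω : ℝ} [Fact (0 < ω)] {ι : Type*} [Fintype ι]
    (η : Measure ℝ) [IsFiniteMeasure η] (s : Set ℝ) {g : ℝ → ℝ} (hg : Continuous g)
    (R : ι → ℝ) (j : ι) :
    Continuous fun p : ℝ × {y : C(AddCircle ω, ι → ℝ) // ∀ θ i, |y θ i| ≤ R i} =>
      ∫ t in s, g (p.2.1 (p.1 + t : ℝ) j) ∂η := by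
  obtain ⟨C, hC⟩ := isCompact_Icc.exists_bound_of_continuousOn
    (hg.continuousOn (s := Set.Icc (-R j) (R j)))
  refine continuous_of_dominated (bound := fun _ => C) (fun p => ?_)
    (fun p => Eventually.of_forall fun t => hC _ (abs_le.1 (p.2.2 _ j))) (integrable_const _)
    (Eventually.of_forall fun t => ?_)
  · have h1 : Continuous fun t : ℝ => p.2.1 (p.1 + t : ℝ) j :=
      (continuous_apply j).comp (p.2.1.continuous.comp
        ((AddCircle.continuous_mk' ω).comp (continuous_const.add continuous_id)))
    exact (hg.comp h1).aestronglyMeasurable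
  · exact hg.comp ((continuous_apply j).comp
      ((continuous_subtype_val.comp continuous_snd).eval
        ((AddCircle.continuous_mk' ω).comp (continuous_fst.add continuous_const))))

namespace HOData

variable {n P Q : ℕ}

/-- The part of the right-hand side that is not multiplied into the amplification and leakage
terms: delayed feedback and input. -/
noncomputable def drive (S : HOData n P Q) (x : Fin (n+1) → ℝ → ℝ) (i : Fin (n+1)) (t : ℝ) : ℝ :=
  S.Gf i (∑ p : Fin (P+1), ∑ j : Fin (n+1), ∑ l : Fin (n+1),
      S.c i j l p t * S.h i j l p (x j (t - S.τ i j p t)) (x l (t - S.σ i l p t)))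
    + S.Hf i (∑ q : Fin (Q+1), ∑ j : Fin (n+1), ∑ l : Fin (n+1),
        S.d i j l q t * S.f i j l q
          (∫ s in Set.Iic (0:ℝ), S.g i j q (x j (t + s)) ∂(S.η i j q))
          (∫ s in Set.Iic (0:ℝ), S.G i l q (x l (t + s)) ∂(S.ρ i l q)))
    + S.I i t

theorem rhs_eq (S : HOData n P Q) (x : Fin (n+1) → ℝ → ℝ) (i : Fin (n+1)) (t : ℝ) :
    S.rhs x i t = S.a i t (x i t) * (-(S.b i t (x i t)) + S.drive x i t) := by
  simp only [rhs, drive, add_assoc]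

theorem continuousOn_drive {S : HOData n P Q} (hS : S.Regular) {ω : ℝ} [Fact (0 < ω)]
    (R : Fin (n+1) → ℝ) (i : Fin (n+1)) :
    ContinuousOn (fun p : ℝ × {y : C(AddCircle ω, Fin (n+1) → ℝ) // ∀ θ i, |y θ i| ≤ R i} =>
      S.drive (fun i t => p.2.1 t i) i p.1) (Set.Ici 0 ×ˢ Set.univ) := by
  obtain ⟨-, -, -, hGf, hHf, hc, hd, hI, hτ, hσ, -, -, hh, hf, hg, hG, hη, hρ⟩ := hS
  have hfst : ContinuousOn Prod.fst (Set.Ici (0 : ℝ) ×ˢ (Set.univ :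
      Set {y : C(AddCircle ω, Fin (n+1) → ℝ) // ∀ θ i, |y θ i| ≤ R i})) := continuousOn_fst
  have hmap : Set.MapsTo Prod.fst (Set.Ici (0 : ℝ) ×ˢ (Set.univ :
      Set {y : C(AddCircle ω, Fin (n+1) → ℝ) // ∀ θ i, |y θ i| ≤ R i})) (Set.Ici 0) :=
    fun p hp => hp.1
  have heval : ∀ (j : Fin (n+1)) (δ : ℝ → ℝ), ContinuousOn δ (Set.Ici 0) →
      ContinuousOn (fun p : ℝ × {y : C(AddCircle ω, Fin (n+1) → ℝ) // ∀ θ i, |y θ i| ≤ R i} =>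
        p.2.1 (p.1 - δ p.1 : ℝ) j) (Set.Ici 0 ×ˢ Set.univ) := fun j δ hδ =>
    (continuous_apply j).comp_continuousOn
      ((continuous_subtype_val.comp continuous_snd).continuousOn.eval
        ((AddCircle.continuous_mk' ω).comp_continuousOn (hfst.sub (hδ.comp hfst hmap))))
  refine (ContinuousOn.add ((hGf i).comp_continuousOn ?_) ((hHf i).comp_continuousOn ?_)).add
    ((hI i).comp hfst hmap)
  · refine continuousOn_finsetSum _ fun p _ => continuousOn_finsetSum _ fun j _ =>
      continuousOn_finsetSum _ fun l _ => ((hc i j l p).comp hfst hmap).mul ?_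
    exact (hh i j l p).comp_continuousOn ((heval j _ (hτ i j p)).prodMk (heval l _ (hσ i l p)))
  · refine continuousOn_finsetSum _ fun q _ => continuousOn_finsetSum _ fun j _ =>
      continuousOn_finsetSum _ fun l _ => ((hd i j l q).comp hfst hmap).mul ?_
    have := (hη i j q).1
    have := (hρ i l q).1
    exact ((hf i j l q).comp ((continuous_setIntegral_comp_add _ _ (hg i j q) R j).prodMk
      (continuous_setIntegral_comp_add _ _ (hG i l q) R l))).continuousOn

theorem continuousOn_drive_zero {S : HOData n P Q} (hS : S.Regular) (i : Fin (n+1)) :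
    ContinuousOn (S.drive (fun _ _ => 0) i) (Set.Ici 0) := by
  have h1 : Continuous fun t : ℝ => ((t, ⟨0, fun _ _ => abs_zero.le⟩) :
      ℝ × {y : C(AddCircle (1 : ℝ), Fin (n+1) → ℝ) // ∀ θ i, |y θ i| ≤ (0 : Fin (n+1) → ℝ) i}) :=
    continuous_id.prodMk continuous_const
  have h2 := (continuousOn_drive hS 0 i).comp (s := Set.Ici 0) h1.continuousOn
    fun t ht => ⟨ht, trivial⟩
  simpa only [Function.comp_def, ContinuousMap.zero_apply, Pi.zero_apply] using h2

theorem continuousOn_rhs {S : HOData n P Q} (hS : S.Regular) {ω : ℝ} [Fact (0 < ω)]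
    (R : Fin (n+1) → ℝ) (i : Fin (n+1)) :
    ContinuousOn (fun p : ℝ × {y : C(AddCircle ω, Fin (n+1) → ℝ) // ∀ θ i, |y θ i| ≤ R i} =>
      S.rhs (fun i t => p.2.1 t i) i p.1) (Set.Ici 0 ×ˢ Set.univ) := by
  have heval : Continuous
      fun p : ℝ × {y : C(AddCircle ω, Fin (n+1) → ℝ) // ∀ θ i, |y θ i| ≤ R i} =>
        (p.1, p.2.1 p.1 i) :=
    continuous_fst.prodMk ((continuous_apply i).comp
      ((continuous_subtype_val.comp continuous_snd).eval
        ((AddCircle.continuous_mk' ω).comp continuous_fst)))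
  have hmap : Set.MapsTo
      (fun p : ℝ × {y : C(AddCircle ω, Fin (n+1) → ℝ) // ∀ θ i, |y θ i| ≤ R i} =>
        (p.1, p.2.1 p.1 i)) (Set.Ici 0 ×ˢ Set.univ) (Set.Ici 0 ×ˢ Set.univ) :=
    fun p hp => ⟨hp.1, trivial⟩
  simp only [rhs_eq]
  exact ((hS.1 i).comp heval.continuousOn hmap).mul
    (((hS.2.2.1 i).comp heval.continuousOn hmap).neg.add (continuousOn_drive hS R i))

theorem rhs_add_period {S : HOData n P Q} {ω : ℝ} (h : S.T3 ω) {y : Fin (n+1) → ℝ → ℝ}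
    (hy : ∀ i t, y i (t + ω) = y i t) (i : Fin (n+1)) {t : ℝ} (ht : 0 ≤ t) :
    S.rhs y i (t + ω) = S.rhs y i t := by
  obtain ⟨ha, hb, hc, hd, hτ, hσ, hI⟩ := h
  simp only [rhs, ha i t ht, hb i t ht, hc i _ _ _ t ht, hd i _ _ _ t ht, hτ i _ _ t ht,
    hσ i _ _ t ht, hI i t ht, hy, add_sub_right_comm, add_right_comm t ω]

/-- The total Lipschitz weight of the delayed feedback at time `t`. -/
noncomputable def feedbackWeight (S : HOData n P Q)
    (γ1 γ2 : Fin (n+1) → Fin (n+1) → Fin (n+1) → Fin (P+1) → ℝ)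
    (μ1 μ2 : Fin (n+1) → Fin (n+1) → Fin (n+1) → Fin (Q+1) → ℝ)
    (ξ Ξ : Fin (n+1) → Fin (n+1) → Fin (Q+1) → ℝ) (ζ ς dv : Fin (n+1) → ℝ)
    (i : Fin (n+1)) (t : ℝ) : ℝ :=
  ∑ j : Fin (n+1), ∑ l : Fin (n+1),
    ((∑ p : Fin (P+1), ζ i * |S.c i j l p t| *
        ((dv j / dv i) * γ1 i j l p + (dv l / dv i) * γ2 i j l p))
      + ∑ q : Fin (Q+1), ς i * |S.d i j l q t| *
        ((dv j / dv i) * μ1 i j l q * ξ i j q + (dv l / dv i) * μ2 i j l q * Ξ i l q))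

theorem continuousOn_feedbackWeight {S : HOData n P Q} (hS : S.Regular)
    (γ1 γ2 : Fin (n+1) → Fin (n+1) → Fin (n+1) → Fin (P+1) → ℝ)
    (μ1 μ2 : Fin (n+1) → Fin (n+1) → Fin (n+1) → Fin (Q+1) → ℝ)
    (ξ Ξ : Fin (n+1) → Fin (n+1) → Fin (Q+1) → ℝ) (ζ ς dv : Fin (n+1) → ℝ) (i : Fin (n+1)) :
    ContinuousOn (S.feedbackWeight γ1 γ2 μ1 μ2 ξ Ξ ζ ς dv i) (Set.Ici 0) := by
  obtain ⟨-, -, -, -, -, hc, hd, -⟩ := hS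
  refine continuousOn_finsetSum _ fun j _ => continuousOn_finsetSum _ fun l _ =>
    (continuousOn_finsetSum _ fun p _ => ?_).add (continuousOn_finsetSum _ fun q _ => ?_)
  · exact (continuousOn_const.mul (hc i j l p).abs).mul continuousOn_const
  · exact (continuousOn_const.mul (hd i j l q).abs).mul continuousOn_const

theorem abs_drive_sub_drive_zero_le {S : HOData n P Q}
    {γ1 γ2 : Fin (n+1) → Fin (n+1) → Fin (n+1) → Fin (P+1) → ℝ}
    {μ1 μ2 : Fin (n+1) → Fin (n+1) → Fin (n+1) → Fin (Q+1) → ℝ}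
    {ξ Ξ : Fin (n+1) → Fin (n+1) → Fin (Q+1) → ℝ} {ζ ς dv : Fin (n+1) → ℝ} (hS : S.Regular)
    (h : S.T2 γ1 γ2 μ1 μ2 ξ Ξ ζ ς) {i : Fin (n+1)} (hi : 0 < dv i) {r : ℝ}
    {y : Fin (n+1) → ℝ → ℝ} (hyc : ∀ j, Continuous (y j)) (hy : ∀ j t, |y j t| ≤ r * dv j)
    (t : ℝ) :
    |S.drive y i t - S.drive (fun _ _ => 0) i t| ≤
      S.feedbackWeight γ1 γ2 μ1 μ2 ξ Ξ ζ ς dv i t * (r * dv i) := by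
  obtain ⟨hγ, hμ, hξ, hΞ, hζ, hh, hf, hg, hG, hGf, hHf⟩ := h
  obtain ⟨-, -, -, -, -, -, -, -, -, -, -, -, -, -, -, -, hη, hρ⟩ := hS
  have hsum : S.feedbackWeight γ1 γ2 μ1 μ2 ξ Ξ ζ ς dv i t * (r * dv i) =
      ζ i * (∑ p, ∑ j, ∑ l, |S.c i j l p t| *
        (γ1 i j l p * (r * dv j) + γ2 i j l p * (r * dv l))) +
      ς i * ∑ q, ∑ j, ∑ l, |S.d i j l q t| *
        (μ1 i j l q * (ξ i j q * (r * dv j)) + μ2 i j l q * (Ξ i l q * (r * dv l))) := by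
    have e1 : ∀ F : Fin (P+1) → Fin (n+1) → Fin (n+1) → ℝ,
        ∑ p, ∑ j, ∑ l, F p j l = ∑ j, ∑ l, ∑ p, F p j l := fun F => by
      rw [Finset.sum_comm]
      exact Finset.sum_congr rfl fun j _ => Finset.sum_comm
    have e2 : ∀ F : Fin (Q+1) → Fin (n+1) → Fin (n+1) → ℝ,
        ∑ p, ∑ j, ∑ l, F p j l = ∑ j, ∑ l, ∑ p, F p j l := fun F => by
      rw [Finset.sum_comm]
      exact Finset.sum_congr rfl fun j _ => Finset.sum_comm
    rw [e1, e2]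
    simp only [feedbackWeight, Finset.sum_add_distrib, add_mul, Finset.sum_mul, Finset.mul_sum]
    have hne := hi.ne'
    congr 1 <;> refine Finset.sum_congr rfl fun j _ => Finset.sum_congr rfl fun l _ =>
      Finset.sum_congr rfl fun p _ => ?_ <;> field_simp
  have hsub : ∀ u v w u' v' w' : ℝ, |u + v + w - (u' + v' + w)| ≤ |u - u'| + |v - v'| :=
    fun u v w u' v' _ => by
      have := abs_add_le (u - u') (v - v')
      rwa [show u - u' + (v - v') = u + v + w - (u' + v' + w) by ring] at this
  rw [hsum]
  refine (hsub _ _ _ _ _ 0).trans (add_le_add ((hGf i _ _).trans ?_) ((hHf i _ _).trans ?_))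
  · refine mul_le_mul_of_nonneg_left ?_ (hζ i).1.le
    simp only [← Finset.sum_sub_distrib, ← mul_sub]
    refine (Finset.abs_sum_le_sum_abs _ _).trans (Finset.sum_le_sum fun p _ =>
      (Finset.abs_sum_le_sum_abs _ _).trans (Finset.sum_le_sum fun j _ =>
      (Finset.abs_sum_le_sum_abs _ _).trans (Finset.sum_le_sum fun l _ => ?_)))
    rw [abs_mul]
    refine mul_le_mul_of_nonneg_left ((hh i j l p _ _ _ _).trans ?_) (abs_nonneg _)
    simp only [sub_zero]
    exact add_le_add (mul_le_mul_of_nonneg_left (hy _ _) (hγ i j l p).1.le)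
      (mul_le_mul_of_nonneg_left (hy _ _) (hγ i j l p).2.le)
  · refine mul_le_mul_of_nonneg_left ?_ (hζ i).2.le
    simp only [← Finset.sum_sub_distrib, ← mul_sub]
    refine (Finset.abs_sum_le_sum_abs _ _).trans (Finset.sum_le_sum fun q _ =>
      (Finset.abs_sum_le_sum_abs _ _).trans (Finset.sum_le_sum fun j _ =>
      (Finset.abs_sum_le_sum_abs _ _).trans (Finset.sum_le_sum fun l _ => ?_)))
    rw [abs_mul]
    refine mul_le_mul_of_nonneg_left ((hf i j l q _ _ _ _).trans ?_) (abs_nonneg _)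
    have := (hη i j q).1
    have := (hρ i l q).1
    exact add_le_add
      (mul_le_mul_of_nonneg_left (abs_setIntegral_comp_sub_le _ (hξ i j q).le (hg i j q)
        ((hyc j).comp (continuous_const.add continuous_id)) fun s => hy j _) (hμ i j l q).1.le)
      (mul_le_mul_of_nonneg_left (abs_setIntegral_comp_sub_le _ (hΞ i l q).le (hG i l q)
        ((hyc l).comp (continuous_const.add continuous_id)) fun s => hy l _) (hμ i j l q).2.le)

end HOData

/-- Theorem 4.3 (existence of a periodic solution of the high-order periodic system). -/
theorem ho_periodic_solution_exists {n P Q : ℕ} (ω : ℝ) (hω : 0 < ω)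
    (S : HOData n P Q)
    (aL aU : Fin (n+1) → ℝ) (A : Fin (n+1) → ℝ → ℝ) (β βs : Fin (n+1) → ℝ → ℝ)
    (γ1 γ2 : Fin (n+1) → Fin (n+1) → Fin (n+1) → Fin (P+1) → ℝ)
    (μ1 μ2 : Fin (n+1) → Fin (n+1) → Fin (n+1) → Fin (Q+1) → ℝ)
    (ξ Ξ : Fin (n+1) → Fin (n+1) → Fin (Q+1) → ℝ) (ζ ς : Fin (n+1) → ℝ)
    (hreg : S.Regular)
    (t1 : S.T1 aL aU A) (t2 : S.T2 γ1 γ2 μ1 μ2 ξ Ξ ζ ς) (t3 : S.T3 ω) (t4 : S.T4 ω β βs)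
    (dv : Fin (n+1) → ℝ) (hdv : ∀ i, 0 < dv i)
    (hdom : ∀ i, ∀ t ∈ Set.Icc (0:ℝ) ω,
      (∑ j : Fin (n+1), ∑ l : Fin (n+1),
        ((∑ p : Fin (P+1), ζ i * |S.c i j l p t| *
            ((dv j / dv i) * γ1 i j l p + (dv l / dv i) * γ2 i j l p))
          + ∑ q : Fin (Q+1), ς i * |S.d i j l q t| *
            ((dv j / dv i) * μ1 i j l q * ξ i j q + (dv l / dv i) * μ2 i j l q * Ξ i l q)))
        < β i t) :
    ∃ xper : Fin (n+1) → ℝ → ℝ,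
      (∀ i, Continuous (xper i)) ∧
      (∀ i, ∀ t : ℝ, xper i (t + ω) = xper i t) ∧
      (∀ i, ∀ t : ℝ, 0 < t → HasDerivAt (xper i) (S.rhs xper i t) t) := by
  have : Fact (0 < ω) := ⟨hω⟩
  have hIcc : Set.Icc 0 ω ⊆ Set.Ici 0 := Set.Icc_subset_Ici_self
  have hδ : ∀ i, ∃ δ > 0, ∀ t ∈ Set.Icc 0 ω,
      S.feedbackWeight γ1 γ2 μ1 μ2 ξ Ξ ζ ς dv i t + δ ≤ β i t := by
    intro i
    obtain ⟨t₀, ht₀, hmin⟩ := isCompact_Icc.exists_isMinOn (Set.nonempty_Icc.2 hω.le)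
      (((t4.1 i).sub (continuousOn_feedbackWeight hreg γ1 γ2 μ1 μ2 ξ Ξ ζ ς dv i)).mono hIcc)
    refine ⟨_, sub_pos.2 (hdom i t₀ ht₀), fun t ht => ?_⟩
    have h1 : β i t₀ - S.feedbackWeight γ1 γ2 μ1 μ2 ξ Ξ ζ ς dv i t₀ ≤
      β i t - S.feedbackWeight γ1 γ2 μ1 μ2 ξ Ξ ζ ς dv i t := hmin ht
    rw [feedbackWeight] at h1
    linarith
  have hN : ∀ i, ∃ N, ∀ t ∈ Set.Icc 0 ω, |-S.b i t 0 + S.drive (fun _ _ => 0) i t| ≤ N := by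
    intro i
    have h1 : ContinuousOn (fun t => S.b i t 0) (Set.Icc 0 ω) :=
      (hreg.2.2.1 i).comp (s := Set.Icc 0 ω) (f := fun t : ℝ => (t, (0 : ℝ)))
        (by fun_prop) fun t ht => ⟨hIcc ht, trivial⟩
    exact isCompact_Icc.exists_bound_of_continuousOn
      (h1.neg.add ((continuousOn_drive_zero hreg i).mono hIcc))
  have hB : ∀ i, ∃ B, ∀ t ∈ Set.Icc 0 ω, |βs i t| ≤ B := fun i =>
    isCompact_Icc.exists_bound_of_continuousOn ((t4.2.1 i).mono hIcc)
  choose δ hδ0 hδ using hδ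
  choose N hN using hN
  choose B hB using hB
  have h0 : (0 : ℝ) ∈ Set.Icc 0 ω := Set.left_mem_Icc.2 hω.le
  have hN0 : ∀ i, 0 ≤ N i := fun i => (abs_nonneg _).trans (hN i 0 h0)
  have hB0 : ∀ i, 0 ≤ B i := fun i => (abs_nonneg _).trans (hB i 0 h0)
  have haU : ∀ i, 0 ≤ aU i := fun i => (t1.1 i).le.trans (t1.2.1 i)
  have hr0 : ∀ i, 0 ≤ N i / (δ i * dv i) := fun i =>
    div_nonneg (hN0 i) (mul_pos (hδ0 i) (hdv i)).le
  have hM0 : ∀ i, 0 ≤ aU i * B i := fun i => mul_nonneg (haU i) (hB0 i)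
  set r := ∑ i, N i / (δ i * dv i) with hr
  set M := 1 + ∑ i, aU i * B i with hM
  have hMpos : 0 < M := by
    have := Finset.sum_nonneg fun i (_ : i ∈ Finset.univ) => hM0 i
    positivity
  have hrpos : 0 ≤ r := Finset.sum_nonneg fun i _ => hr0 i
  refine exists_periodic_solution_of_box hω (fun i => r * dv i)
    (fun i => mul_nonneg hrpos (hdv i).le) hMpos S.rhs (fun i => continuousOn_rhs hreg _ i)
    (fun y hy i t ht => rhs_add_period t3 hy i ht) fun y hyc hyp hyR i t ht => ?_
  have ht0 : 0 ≤ t := ht.1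
  rw [rhs_eq]
  refine abs_mul_add_mul_le_of_slope (hreg.2.1 i t ht0 _).le (t1.2.2.1 i t ht0 _).2
    (t4.2.2.1 i t ht0).2.le (t4.2.2.2.2 i t ht0) (hyR i t) ?_ ?_
  · have h1 := abs_drive_sub_drive_zero_le hreg t2 (hdv i) hyc hyR t
    have h2 : N i ≤ δ i * (r * dv i) := by
      have := Finset.single_le_sum (fun i _ => hr0 i) (Finset.mem_univ i)
      rw [← hr, div_le_iff₀ (mul_pos (hδ0 i) (hdv i))] at this
      linarith
    have h3 := abs_add_le (-S.b i t 0 + S.drive (fun _ _ => 0) i t)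
      (S.drive y i t - S.drive (fun _ _ => 0) i t)
    have h4 := mul_le_mul_of_nonneg_right (hδ i t ht) (mul_nonneg hrpos (hdv i).le)
    rw [add_add_sub_cancel] at h3
    linarith [hN i t ht]
  · have h1 := Finset.single_le_sum (fun i _ => hM0 i) (Finset.mem_univ i)
    have h2 := mul_le_mul_of_nonneg_left ((le_abs_self _).trans (hB i t ht)) (haU i)
    linarith
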